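/- For every positive integer C and every ε > 0 there is N such that for all n ≥ N, setting k = k₀(n) − C, one has n^{C−1−ε} < f_n(k) < n^C. -/

import Mathlib

/-- `fExp n k` is the expected number of `k`-cliques in `G_{n,1/2}`,
i.e. `C(n,k) · 2^{-C(k,2)}`. -/
noncomputable def fExp (n k : ℕ) : ℝ := (n.choose k : ℝ) / 2 ^ (k.choose 2)

/-- `kZero n = min {k : fExp n k < 1}`. -/
noncomputable def kZero (n : ℕ) : ℕ := sInf {k | fExp n k < 1}

theorem fExp_kZero_lt_one (n : ℕ) : fExp n (kZero n) < 1 := by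
  have h : {k | fExp n k < 1}.Nonempty := ⟨n + 1, by simp [fExp]⟩
  exact Nat.sInf_mem h

theorem one_le_fExp_of_lt_kZero {n k : ℕ} (h : k < kZero n) : 1 ≤ fExp n k :=
  not_lt.mp (Nat.notMem_of_lt_sInf (s := {k | fExp n k < 1}) h)

theorem fExp_nonneg (n k : ℕ) : 0 ≤ fExp n k := by
  unfold fExp; positivity

theorem fExp_mul_sub {n k : ℕ} (h : k ≤ n) :
    fExp n k * ((n : ℝ) - k) = fExp n (k + 1) * ((k + 1) * 2 ^ k) := by
  have h1 : (n.choose (k + 1) : ℝ) * (k + 1) = n.choose k * ((n : ℝ) - k) := by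
    have := Nat.choose_succ_right_eq n k
    rw [← Nat.cast_sub h]
    exact_mod_cast this
  have h2 : (k + 1).choose 2 = k + k.choose 2 := by
    rw [Nat.choose_succ_succ' k 1, Nat.choose_one_right]
  unfold fExp
  rw [h2, pow_add]
  field_simp
  linarith

theorem two_pow_choose_two_sq (k : ℕ) : ((2 : ℝ) ^ k.choose 2) ^ 2 = (2 ^ (k - 1)) ^ k := by
  rw [← pow_mul, ← pow_mul, Nat.choose_two_right,
    Nat.div_mul_cancel (Nat.even_mul_pred_self k).two_dvd, mul_comm]

theorem div_pow_le_choose {n k : ℕ} (h : k ≤ n) : ((n : ℝ) / k) ^ k ≤ n.choose k := by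
  induction k generalizing n with
  | zero => simp
  | succ k ih =>
    obtain ⟨n, rfl⟩ : ∃ m, n = m + 1 := ⟨n - 1, by omega⟩
    have hkn : k ≤ n := by omega
    have h1 : (((n + 1 : ℕ) : ℝ) / (k + 1 : ℕ)) ^ k ≤ ((n : ℝ) / k) ^ k := by
      rcases Nat.eq_zero_or_pos k with rfl | hk
      · simp
      · have hk' : (0 : ℝ) < k := by exact_mod_cast hk
        have hkn' : (k : ℝ) ≤ n := by exact_mod_cast hkn
        refine pow_le_pow_left₀ (by positivity) ?_ k
        rw [div_le_div_iff₀ (by positivity) hk']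
        push_cast
        nlinarith
    have h2 : ((n + 1).choose (k + 1) : ℝ) = ((n + 1 : ℕ) : ℝ) / (k + 1 : ℕ) * n.choose k := by
      rw [div_mul_eq_mul_div, eq_div_iff (by positivity)]
      exact_mod_cast (Nat.add_one_mul_choose_eq n k).symm
    rw [h2, pow_succ']
    gcongr
    exact h1.trans (ih hkn)

theorem kZero_pos (n : ℕ) : 0 < kZero n := by
  by_contra! h
  have := fExp_kZero_lt_one n
  rw [Nat.le_zero.mp h] at this
  simp [fExp] at this

theorem sq_lt_kZero_sq_mul_two_pow (n : ℕ) :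
    (n : ℝ) ^ 2 < (kZero n : ℝ) ^ 2 * 2 ^ (kZero n - 1) := by
  have hK := kZero_pos n
  have hf := fExp_kZero_lt_one n
  set K := kZero n
  have hK' : (0 : ℝ) < K := by exact_mod_cast hK
  rcases le_or_gt K n with hle | hlt
  · unfold fExp at hf
    rw [div_lt_one (by positivity)] at hf
    have h1 : ((n : ℝ) / K) ^ K < 2 ^ K.choose 2 := (div_pow_le_choose hle).trans_lt hf
    have h2 : (((n : ℝ) / K) ^ 2) ^ K < (2 ^ (K - 1)) ^ K := by
      rw [← two_pow_choose_two_sq, pow_right_comm]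
      gcongr
    have h3 := lt_of_pow_lt_pow_left₀ K (by positivity) h2
    rw [div_pow, div_lt_iff₀ (by positivity)] at h3
    linarith
  · have h1 : (n : ℝ) ^ 2 < (K : ℝ) ^ 2 := by gcongr
    have h2 : (1 : ℝ) ≤ 2 ^ (K - 1) := one_le_pow₀ (by norm_num)
    nlinarith [sq_nonneg (K : ℝ)]

theorem sq_mul_two_pow_le_of_one_le_fExp {n k : ℕ} (hk : 0 < k) (h : 1 ≤ fExp n k) :
    (k : ℝ) ^ 2 * 2 ^ (k - 1) ≤ 9 * n ^ 2 := by
  unfold fExp at h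
  rw [one_le_div (by positivity)] at h
  have h1 : (2 : ℝ) ^ k.choose 2 * k.factorial ≤ n ^ k := by
    rw [← le_div_iff₀ (by positivity)]
    exact h.trans (Nat.choose_le_pow_div k n)
  have h2 : (k : ℝ) ^ k ≤ 3 ^ k * k.factorial := by
    have := Real.pow_div_factorial_le_exp (k : ℝ) (by positivity) k
    rw [div_le_iff₀ (by positivity)] at this
    refine this.trans ?_
    gcongr
    rw [← Real.exp_one_pow]
    gcongr
    exact Real.exp_one_lt_three.le
  have h3 : (2 : ℝ) ^ k.choose 2 * (k : ℝ) ^ k ≤ (3 * n) ^ k := by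
    calc (2 : ℝ) ^ k.choose 2 * (k : ℝ) ^ k
        ≤ 2 ^ k.choose 2 * (3 ^ k * k.factorial) := by gcongr
      _ = 3 ^ k * (2 ^ k.choose 2 * k.factorial) := by ring
      _ ≤ 3 ^ k * n ^ k := by gcongr
      _ = (3 * n) ^ k := by rw [mul_pow]
  have h4 : ((k : ℝ) ^ 2 * 2 ^ (k - 1)) ^ k ≤ ((3 * (n : ℝ)) ^ 2) ^ k := by
    calc ((k : ℝ) ^ 2 * (2 : ℝ) ^ (k - 1)) ^ k = ((2 : ℝ) ^ k.choose 2 * (k : ℝ) ^ k) ^ 2 := by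
          rw [mul_pow, mul_pow, two_pow_choose_two_sq, pow_right_comm, mul_comm]
      _ ≤ ((3 * (n : ℝ)) ^ k) ^ 2 := by gcongr
      _ = ((3 * (n : ℝ)) ^ 2) ^ k := pow_right_comm _ _ _
  have h5 := le_of_pow_le_pow_left₀ hk.ne' (by positivity) h4
  linarith

theorem tendsto_kZero_atTop : Filter.Tendsto kZero Filter.atTop Filter.atTop := by
  refine Filter.tendsto_atTop.mpr fun m ↦ ?_
  obtain ⟨N, hN⟩ := exists_nat_gt ((m : ℝ) ^ 2 * 2 ^ m)
  filter_upwards [Filter.eventually_ge_atTop (N + 1)] with n hn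
  by_contra! hlt
  have h1 := sq_lt_kZero_sq_mul_two_pow n
  have h2 : (kZero n : ℝ) ^ 2 * 2 ^ (kZero n - 1) ≤ (m : ℝ) ^ 2 * 2 ^ m := by
    gcongr
    · norm_num
    · omega
  have h3 : (N : ℝ) + 1 ≤ n := by exact_mod_cast hn
  nlinarith [(Nat.cast_nonneg N : (0 : ℝ) ≤ N)]

theorem eventually_mul_pow_lt_two_pow (a : ℝ) (p : ℕ) :
    ∀ᶠ k : ℕ in Filter.atTop, a * (k : ℝ) ^ p < 2 ^ k := by
  have h := (tendsto_pow_const_div_const_pow_of_one_lt p (one_lt_two (α := ℝ))).const_mul a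
  rw [mul_zero] at h
  filter_upwards [h.eventually_lt_const one_pos] with k hk
  rwa [← mul_div_assoc, div_lt_one (by positivity)] at hk

theorem fExp_sub_le {n K : ℕ} {u : ℝ} (hu : 0 ≤ u)
    (h : ∀ k < K, fExp n k ≤ u * fExp n (k + 1)) :
    ∀ j ≤ K, fExp n (K - j) ≤ u ^ j * fExp n K := by
  intro j
  induction j with
  | zero => simp
  | succ j ih =>
    intro hj
    have h1 := h (K - (j + 1)) (by omega)
    rw [show K - (j + 1) + 1 = K - j by omega] at h1
    calc _ ≤ u * fExp n (K - j) := h1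
      _ ≤ u * (u ^ j * fExp n K) := by gcongr; exact ih (by omega)
      _ = _ := by ring

theorem le_fExp_sub {n K c : ℕ} {l : ℝ} (hl : 0 ≤ l) (hc : c ≤ K)
    (h : ∀ k < K, K ≤ k + c → l * fExp n (k + 1) ≤ fExp n k) :
    ∀ j ≤ c, l ^ j * fExp n K ≤ fExp n (K - j) := by
  intro j
  induction j with
  | zero => simp
  | succ j ih =>
    intro hj
    have h1 := h (K - (j + 1)) (by omega) (by omega)
    rw [show K - (j + 1) + 1 = K - j by omega] at h1
    calc _ = l * (l ^ j * fExp n K) := by ring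
      _ ≤ l * fExp n (K - j) := by gcongr; exact ih (by omega)
      _ ≤ _ := h1

theorem fExp_kZero_sub_lt {n c : ℕ} (hn : 0 < n) (hc : c ≤ kZero n) (h39 : 39 ≤ kZero n)
    (hK : 2 * kZero n ≤ n) : fExp n (kZero n - c) < (n : ℝ) ^ c := by
  have hf := fExp_kZero_lt_one n
  have hp := sq_mul_two_pow_le_of_one_le_fExp (n := n) (k := kZero n - 1) (by omega)
    (one_le_fExp_of_lt_kZero (by omega))
  set K := kZero n
  obtain ⟨m, hm⟩ : ∃ m, K = m + 2 := ⟨K - 2, by omega⟩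
  have hn' : (0 : ℝ) < n := by exact_mod_cast hn
  have hKn : (2 : ℝ) * K ≤ n := by exact_mod_cast hK
  have key : (K : ℝ) * 2 ^ (K - 1) * 2 ≤ n * n := by
    rw [hm] at hp ⊢
    simp only [Nat.add_sub_cancel, show m + 2 - 1 = m + 1 by omega] at hp ⊢
    have hm' : (37 : ℝ) ≤ m := by exact_mod_cast (by omega : 37 ≤ m)
    push_cast at hp ⊢
    have h1 : 36 * ((m : ℝ) + 2) ≤ (m + 1) ^ 2 := by nlinarith
    have h2 : 36 * ((m : ℝ) + 2) * 2 ^ m ≤ (m + 1) ^ 2 * 2 ^ m := by gcongr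
    rw [pow_succ]
    nlinarith
  have hstep : ∀ k < K, fExp n k ≤ n * fExp n (k + 1) := by
    intro k hk
    have hk' : (k : ℝ) + 1 ≤ K := by exact_mod_cast hk
    have h1 := fExp_mul_sub (n := n) (k := k) (by omega)
    have h2 : ((k : ℝ) + 1) * 2 ^ k ≤ K * 2 ^ (K - 1) := by
      gcongr
      · norm_num
      · omega
    have h3 : ((k : ℝ) + 1) * 2 ^ k ≤ n * (n - k) := by nlinarith
    have h4 : 0 < (n : ℝ) - k := by linarith
    refine le_of_mul_le_mul_right ?_ h4
    rw [h1]
    nlinarith [mul_le_mul_of_nonneg_left h3 (fExp_nonneg n (k + 1))]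
  calc _ ≤ (n : ℝ) ^ c * fExp n K := fExp_sub_le hn'.le hstep c hc
    _ < (n : ℝ) ^ c * 1 := by gcongr
    _ = _ := mul_one _

theorem pow_div_pow_le_fExp_kZero_sub {n c : ℕ} (hn : 0 < n) (hc : c + 1 ≤ kZero n)
    (hK : kZero n ≤ n) :
    (n : ℝ) ^ c / (2 ^ c * (kZero n : ℝ) ^ 2) ^ c ≤ fExp n (kZero n - (c + 1)) := by
  have hf : 1 ≤ fExp n (kZero n - 1) := one_le_fExp_of_lt_kZero (by omega)
  have hlow := sq_lt_kZero_sq_mul_two_pow n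
  set K := kZero n
  have hn' : (0 : ℝ) < n := by exact_mod_cast hn
  have hK0 : (0 : ℝ) < K := by exact_mod_cast (by omega : 0 < K)
  have hstep : ∀ k < K - 1, K - 1 ≤ k + c →
      n / (2 ^ c * (K : ℝ) ^ 2) * fExp n (k + 1) ≤ fExp n k := by
    intro k hk hkc
    have h0 := fExp_nonneg n (k + 1)
    have h1 := fExp_mul_sub (n := n) (k := k) (by omega)
    have h2 : (2 : ℝ) ^ (K - 1) ≤ 2 ^ c * 2 ^ k := by
      rw [← pow_add]
      exact pow_le_pow_right₀ (by norm_num) (by omega)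
    have h3 : (n : ℝ) ^ 2 ≤ 2 ^ c * (K : ℝ) ^ 2 * ((k + 1) * 2 ^ k) := by
      calc (n : ℝ) ^ 2 ≤ K ^ 2 * (2 ^ c * 2 ^ k) := hlow.le.trans (by gcongr)
        _ = 2 ^ c * (K : ℝ) ^ 2 * (1 * 2 ^ k) := by ring
        _ ≤ _ := by gcongr; linarith [(Nat.cast_nonneg k : (0 : ℝ) ≤ k)]
    rw [div_mul_eq_mul_div, div_le_iff₀ (by positivity)]
    refine le_of_mul_le_mul_right ?_ hn'
    calc n * fExp n (k + 1) * n = n ^ 2 * fExp n (k + 1) := by ring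
      _ ≤ 2 ^ c * (K : ℝ) ^ 2 * ((k + 1) * 2 ^ k) * fExp n (k + 1) := by gcongr
      _ = 2 ^ c * (K : ℝ) ^ 2 * (fExp n k * (n - k)) := by rw [h1]; ring
      _ ≤ 2 ^ c * (K : ℝ) ^ 2 * (fExp n k * n) := by
        have := fExp_nonneg n k
        gcongr
        linarith [(Nat.cast_nonneg k : (0 : ℝ) ≤ k)]
      _ = _ := by ring
  have h := le_fExp_sub (by positivity) (by omega) hstep c le_rfl
  rw [show K - 1 - c = K - (c + 1) by omega, div_pow] at h
  exact (le_mul_of_one_le_right (by positivity) hf).trans h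

/-- For every positive integer `C` and every `ε > 0` there is `N` such that for all
`n ≥ N`, with `k = k₀(n) - C`, one has `n^{C-1-ε} < f_n(k) < n^C`. -/
theorem stmt15 (C : ℕ) (hC : 0 < C) (ε : ℝ) (hε : 0 < ε) :
    ∃ N : ℕ, ∀ n, N ≤ n →
      (n : ℝ) ^ ((C : ℝ) - 1 - ε) < fExp n (kZero n - C) ∧
        fExp n (kZero n - C) < (n : ℝ) ^ (C : ℝ) := by
  obtain ⟨c, rfl⟩ : ∃ c, C = c + 1 := ⟨C - 1, by omega⟩
  obtain ⟨M, hM⟩ := exists_nat_gt (2 / ε)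
  rw [div_lt_iff₀ hε] at hM
  rw [← Filter.eventually_atTop]
  filter_upwards [Filter.eventually_gt_atTop 0,
    tendsto_kZero_atTop.eventually (Filter.eventually_ge_atTop (c + 39)),
    tendsto_kZero_atTop.eventually (eventually_mul_pow_lt_two_pow 144 2),
    tendsto_kZero_atTop.eventually
      (eventually_mul_pow_lt_two_pow (36 * ((2 ^ c) ^ c) ^ M) (2 * c * M))] with n hn hK h2 hD
  have hn' : (1 : ℝ) ≤ n := by exact_mod_cast hn
  have hp : (2 : ℝ) ^ kZero n ≤ 36 * n ^ 2 := by
    have h := sq_mul_two_pow_le_of_one_le_fExp (n := n) (k := kZero n - 1) (by omega)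
      (one_le_fExp_of_lt_kZero (by omega))
    obtain ⟨m, hm⟩ : ∃ m, kZero n = m + 2 := ⟨kZero n - 2, by omega⟩
    simp only [hm, Nat.add_sub_cancel, show m + 2 - 1 = m + 1 by omega] at h ⊢
    push_cast at h
    have h3 : (1 : ℝ) * 2 ^ m ≤ ((m : ℝ) + 1) ^ 2 * 2 ^ m := by
      gcongr
      exact one_le_pow₀ (by linarith [(Nat.cast_nonneg m : (0 : ℝ) ≤ m)])
    rw [pow_add]
    linarith
  have hKn : 2 * kZero n ≤ n := by
    have h : ((2 * kZero n : ℕ) : ℝ) ^ 2 ≤ (n : ℝ) ^ 2 := by push_cast; linarith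
    exact_mod_cast le_of_pow_le_pow_left₀ two_ne_zero (by positivity) h
  refine ⟨?_, by
    rw [Real.rpow_natCast]
    exact fExp_kZero_sub_lt hn (by omega) (by omega) hKn⟩
  refine lt_of_lt_of_le ?_ (pow_div_pow_le_fExp_kZero_sub hn (by omega) (by omega))
  have hK0 : (0 : ℝ) < kZero n := by exact_mod_cast kZero_pos n
  have hlt : (2 ^ c * (kZero n : ℝ) ^ 2) ^ c < (n : ℝ) ^ ε := by
    refine lt_of_pow_lt_pow_left₀ M (by positivity) ?_
    calc ((2 ^ c * (kZero n : ℝ) ^ 2) ^ c) ^ M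
        = ((2 ^ c) ^ c) ^ M * (kZero n : ℝ) ^ (2 * c * M) := by
          rw [mul_pow, mul_pow, pow_mul, pow_mul]
      _ < (n : ℝ) ^ 2 := by linarith
      _ = (n : ℝ) ^ (2 : ℝ) := by norm_cast
      _ ≤ (n : ℝ) ^ (ε * M) := Real.rpow_le_rpow_of_exponent_le hn' (by linarith)
      _ = ((n : ℝ) ^ ε) ^ M := Real.rpow_mul_natCast (by positivity) _ _
  rw [show ((c + 1 : ℕ) : ℝ) - 1 - ε = c - ε by push_cast; ring,
    Real.rpow_sub (by positivity), Real.rpow_natCast]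
  gcongr
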